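/- arXiv:1902.03367 — 3 statements merged into one kernel-verified Lean document; each statement's English description precedes it below -/
import Mathlib

section
/- Let Ω = [0,1]^d with |Ω| = 1 and let α > 0. Let μ : [0,1] × Ω → ℝ be C¹ with μ ≥ 0, v : [0,1] × Ω → ℝ^d be C¹ with zero-flux boundary condition μ(t,x) v(t,x)·n(x) = 0 on the boundary of Ω, and f : [0,1] → ℝ continuous, satisfying the unnormalized continuity equation ∂_t μ(t,x) + ∇·(μ(t,x) v(t,x)) = f(t) on [0,1] × Ω. Set m(x) = ∫₀¹ μ(t,x) v(t,x) dt, μ₀ = μ(0,·), μ₁ = μ(1,·). Then ∫₀¹ ∫_Ω ‖v(t,x)‖ μ(t,x) dx dt + (1/α) ∫₀¹ |f(t)| dt ≥ ∫_Ω ‖m(x)‖ dx + (1/α) |∫_Ω μ₀(x) dx − ∫_Ω μ₁(x) dx|. -/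
open MeasureTheory

/-- The unit cube `Ω = [0,1]^d` in `ℝ^d` (with `|Ω| = 1`). -/
def cube (d : ℕ) : Set (EuclideanSpace ℝ (Fin d)) :=
  {x | ∀ i, x i ∈ Set.Icc (0:ℝ) 1}

/-- The (spatial) divergence of a vector field `w` on `ℝ^d` at a point `x`. -/
noncomputable def diverg {d : ℕ}
    (w : EuclideanSpace ℝ (Fin d) → EuclideanSpace ℝ (Fin d))
    (x : EuclideanSpace ℝ (Fin d)) : ℝ :=
  ∑ i, fderiv ℝ w x (EuclideanSpace.single i 1) i

lemma toLp_preimage_cube (d : ℕ) :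
    WithLp.toLp 2 ⁻¹' cube d = Set.Icc (0 : Fin d → ℝ) 1 := by
  ext y
  simp [cube, Pi.le_def, forall_and]

lemma isCompact_cube (d : ℕ) : IsCompact (cube d) := by
  have h : cube d = WithLp.toLp 2 '' Set.Icc (0 : Fin d → ℝ) 1 := by
    rw [← toLp_preimage_cube, Set.image_preimage_eq _ (WithLp.toLp_surjective 2)]
  rw [h]
  exact isCompact_Icc.image (PiLp.continuous_toLp 2 _)

lemma volume_cube (d : ℕ) : volume (cube d) = 1 := by
  rw [← (PiLp.volume_preserving_toLp (Fin d)).measure_preimage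
    (isCompact_cube d).isClosed.measurableSet.nullMeasurableSet, toLp_preimage_cube,
    Real.volume_Icc_pi]
  simp

lemma setIntegral_cube_eq {d : ℕ} (g : EuclideanSpace ℝ (Fin d) → ℝ) :
    ∫ x in cube d, g x = ∫ y in Set.Icc (0 : Fin d → ℝ) 1, g (WithLp.toLp 2 y) := by
  rw [← toLp_preimage_cube]
  exact ((PiLp.volume_preserving_toLp (Fin d)).setIntegral_preimage_emb
    (MeasurableEquiv.toLp 2 (Fin d → ℝ)).measurableEmbedding g (cube d)).symm

lemma continuous_diverg {d : ℕ} {w : EuclideanSpace ℝ (Fin d) → EuclideanSpace ℝ (Fin d)}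
    (hw : ContDiff ℝ 1 w) : Continuous (diverg w) := by
  have h := hw.continuous_fderiv one_ne_zero
  unfold diverg
  fun_prop

/-- The divergence of a field with vanishing normal component on the boundary of the cube
integrates to zero. -/
lemma integral_diverg_cube_eq_zero {d : ℕ}
    {w : EuclideanSpace ℝ (Fin d) → EuclideanSpace ℝ (Fin d)} (hw : ContDiff ℝ 1 w)
    (hflux : ∀ x ∈ cube d, ∀ i, (x i = 0 ∨ x i = 1) → w x i = 0) :
    ∫ x in cube d, diverg w x = 0 := by
  cases d with
  | zero => simp [diverg]
  | succ n =>
    let L := (PiLp.continuousLinearEquiv 2 ℝ (fun _ : Fin (n + 1) => ℝ))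
    let w' : (Fin (n + 1) → ℝ) → (Fin (n + 1) → ℝ) →L[ℝ] (Fin (n + 1) → ℝ) := fun y =>
      (L : _ →L[ℝ] _) ∘L fderiv ℝ w (WithLp.toLp 2 y) ∘L (L.symm : _ →L[ℝ] _)
    have hdiv : ∀ y, ∑ i, w' y (Pi.single i 1) i = diverg w (WithLp.toLp 2 y) := fun y => rfl
    have hd : ∀ y, HasFDerivAt (fun y => (w (WithLp.toLp 2 y)).ofLp) (w' y) y := fun y =>
      L.hasFDerivAt.comp y
        (((hw.differentiable one_ne_zero _).hasFDerivAt).comp y L.symm.hasFDerivAt)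
    have key := integral_divergence_of_hasFDerivAt_off_countable (0 : Fin (n + 1) → ℝ) 1
      zero_le_one (fun y => (w (WithLp.toLp 2 y)).ofLp) w' ∅ Set.countable_empty
      (fun y _ => (hd y).continuousAt.continuousWithinAt) (fun y _ => hd y)
      (by
        simp only [hdiv]
        exact ((continuous_diverg hw).comp (PiLp.continuous_toLp 2 _)).integrableOn_Icc)
    simp only [hdiv] at key
    rw [setIntegral_cube_eq, key]
    refine Finset.sum_eq_zero fun i _ => ?_
    have hface : ∀ c : ℝ, c = 0 ∨ c = 1 →
        ∫ x in Set.Icc ((0 : Fin (n + 1) → ℝ) ∘ i.succAbove) ((1 : Fin (n + 1) → ℝ) ∘ i.succAbove),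
          (w (WithLp.toLp 2 (i.insertNth c x))).ofLp i = 0 := by
      intro c hc
      refine setIntegral_eq_zero_of_forall_eq_zero fun x hx => hflux _ ?_ i (by simpa using hc)
      intro j
      rcases Fin.eq_self_or_eq_succAbove i j with rfl | ⟨k, rfl⟩
      · rcases hc with rfl | rfl <;> simp
      · simpa using ⟨hx.1 k, hx.2 k⟩
    rw [Pi.one_apply, Pi.zero_apply, hface 1 (Or.inr rfl), hface 0 (Or.inl rfl), sub_zero]

lemma intervalIntegral_setIntegral_swap_of_continuous {X : Type*} [TopologicalSpace X]
    [MeasurableSpace X] [OpensMeasurableSpace X] [SecondCountableTopology X] {ν : Measure X}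
    [IsFiniteMeasureOnCompacts ν] [SFinite ν] {K : Set X} (hK : IsCompact K)
    (hKm : MeasurableSet K) {g : ℝ → X → ℝ} (hg : Continuous (Function.uncurry g)) (a b : ℝ) :
    ∫ t in a..b, ∫ x in K, g t x ∂ν = ∫ x in K, (∫ t in a..b, g t x) ∂ν := by
  refine intervalIntegral_integral_swap ?_
  have h : IntegrableOn (Function.uncurry g) (Set.uIcc a b ×ˢ K) (volume.prod ν) :=
    hg.continuousOn.integrableOn_compact' (isCompact_uIcc.prod hK)
      (measurableSet_uIcc.prod hKm)
  rw [Measure.prod_restrict]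
  exact h.mono_set (Set.prod_mono_left Set.uIoc_subset_uIcc)

/-- The total mass changes only through the source term. -/
lemma integral_sub_integral_eq_of_continuity_equation {d : ℕ}
    {μ : ℝ → EuclideanSpace ℝ (Fin d) → ℝ}
    {w : ℝ → EuclideanSpace ℝ (Fin d) → EuclideanSpace ℝ (Fin d)} {f : ℝ → ℝ}
    (hμ : ContDiff ℝ 1 (fun p : ℝ × EuclideanSpace ℝ (Fin d) => μ p.1 p.2))
    (hw : ContDiff ℝ 1 (fun p : ℝ × EuclideanSpace ℝ (Fin d) => w p.1 p.2))
    (hflux : ∀ t ∈ Set.Icc (0:ℝ) 1, ∀ x ∈ cube d, ∀ i, (x i = 0 ∨ x i = 1) → w t x i = 0)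
    (hpde : ∀ t ∈ Set.Icc (0:ℝ) 1, ∀ x ∈ cube d,
      deriv (fun s => μ s x) t + diverg (w t) x = f t) :
    (∫ x in cube d, μ 1 x) - ∫ x in cube d, μ 0 x = ∫ t in (0:ℝ)..1, f t := by
  have hK := isCompact_cube d
  have hKm := hK.isClosed.measurableSet
  have hwt : ∀ t, ContDiff ℝ 1 (w t) := fun t => hw.comp (contDiff_prodMk_right t)
  have hμt : ∀ t, Continuous (μ t) := fun t => (hμ.comp (contDiff_prodMk_right t)).continuous
  have hd : ∀ t x, HasDerivAt (fun s => μ s x)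
      (fderiv ℝ (fun p : ℝ × EuclideanSpace ℝ (Fin d) => μ p.1 p.2) (t, x) (1, 0)) t :=
    fun t x => ((hμ.differentiable one_ne_zero (t, x)).hasFDerivAt).comp_hasDerivAt
      (f := fun s => (s, x)) t
      ((hasDerivAt_id t).prodMk (hasDerivAt_const t x))
  have hcont : Continuous (Function.uncurry fun t x => deriv (fun s => μ s x) t) := by
    have h := hμ.continuous_fderiv one_ne_zero
    simp only [Function.uncurry_def, fun t x => (hd t x).deriv]
    fun_prop
  have hct : ∀ x, Continuous fun t => deriv (fun s => μ s x) t := fun x =>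
    hcont.comp (by fun_prop : Continuous fun t : ℝ => (t, x))
  have hftc : ∀ x, ∫ t in (0:ℝ)..1, deriv (fun s => μ s x) t = μ 1 x - μ 0 x := fun x =>
    intervalIntegral.integral_deriv_eq_sub (fun t _ => (hd t x).differentiableAt)
      ((hct x).intervalIntegrable 0 1)
  rw [← integral_sub ((hμt 1).continuousOn.integrableOn_compact hK)
    ((hμt 0).continuousOn.integrableOn_compact hK)]
  simp only [← hftc]
  rw [← intervalIntegral_setIntegral_swap_of_continuous hK hKm hcont]
  refine intervalIntegral.integral_congr fun t ht => ?_
  rw [Set.uIcc_of_le zero_le_one] at ht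
  have hdiv : IntegrableOn (diverg (w t)) (cube d) :=
    (continuous_diverg (hwt t)).continuousOn.integrableOn_compact hK
  calc ∫ x in cube d, deriv (fun s => μ s x) t
      = ∫ x in cube d, (f t - diverg (w t) x) :=
        setIntegral_congr_fun hKm fun x hx => eq_sub_of_add_eq (hpde t ht x hx)
    _ = f t := by
        have hconst : IntegrableOn (fun _ => f t) (cube d) :=
          integrableOn_const (by simp [volume_cube])
        rw [integral_sub hconst hdiv,
          integral_diverg_cube_eq_zero (hwt t) (hflux t ht)]
        simp [Measure.real, volume_cube]

/-- For any feasible triple `(μ, v, f)` of the dynamical L¹ unnormalized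
optimal transport problem on the unit cube `Ω = [0,1]^d` (so `|Ω| = 1`), the dynamical
cost `∫₀¹∫_Ω ‖v‖ μ + (1/α)∫₀¹|f|` dominates the static cost
`∫_Ω ‖m‖ + (1/α)|∫_Ω μ₀ - ∫_Ω μ₁|`, where `m(x) = ∫₀¹ μ(t,x) v(t,x) dt`. -/
theorem stmt3 {d : ℕ} (α : ℝ) (hα : 0 < α)
    (μ : ℝ → EuclideanSpace ℝ (Fin d) → ℝ)
    (v : ℝ → EuclideanSpace ℝ (Fin d) → EuclideanSpace ℝ (Fin d))
    (f : ℝ → ℝ)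
    (hμ : ContDiff ℝ 1 (fun p : ℝ × EuclideanSpace ℝ (Fin d) => μ p.1 p.2))
    (hμnonneg : ∀ t ∈ Set.Icc (0:ℝ) 1, ∀ x ∈ cube d, 0 ≤ μ t x)
    (hv : ContDiff ℝ 1 (fun p : ℝ × EuclideanSpace ℝ (Fin d) => v p.1 p.2))
    (hf : ContinuousOn f (Set.Icc 0 1))
    (hflux : ∀ t ∈ Set.Icc (0:ℝ) 1, ∀ x ∈ cube d, ∀ i : Fin d,
      (x i = 0 ∨ x i = 1) → μ t x * v t x i = 0)
    (hpde : ∀ t ∈ Set.Icc (0:ℝ) 1, ∀ x ∈ cube d,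
      deriv (fun s => μ s x) t + diverg (fun y => μ t y • v t y) x = f t)
    (m : EuclideanSpace ℝ (Fin d) → EuclideanSpace ℝ (Fin d))
    (hm : ∀ x, m x = ∫ t in (0:ℝ)..1, μ t x • v t x) :
    (∫ x in cube d, ‖m x‖)
        + (1/α) * |(∫ x in cube d, μ 0 x) - ∫ x in cube d, μ 1 x|
      ≤ (∫ t in (0:ℝ)..1, ∫ x in cube d, ‖v t x‖ * μ t x)
        + (1/α) * ∫ t in (0:ℝ)..1, |f t| := by
  have hK := isCompact_cube d
  have hKm := hK.isClosed.measurableSet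
  have hw : ContDiff ℝ 1 fun p : ℝ × EuclideanSpace ℝ (Fin d) => μ p.1 p.2 • v p.1 p.2 :=
    hμ.smul hv
  have hwc := hw.continuous
  have hm_cont : Continuous m := by
    rw [funext hm]
    exact intervalIntegral.continuous_parametric_intervalIntegral_of_continuous'
      (f := fun x t => μ t x • v t x) (hwc.comp continuous_swap) 0 1
  have hN : Continuous (Function.uncurry fun x t => ‖μ t x • v t x‖) :=
    (hwc.comp continuous_swap).norm
  have hN_cont : Continuous fun x => ∫ t in (0:ℝ)..1, ‖μ t x • v t x‖ :=
    intervalIntegral.continuous_parametric_intervalIntegral_of_continuous' hN 0 1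
  have hflow : ∫ x in cube d, ‖m x‖ ≤ ∫ t in (0:ℝ)..1, ∫ x in cube d, ‖v t x‖ * μ t x :=
    calc ∫ x in cube d, ‖m x‖
        ≤ ∫ x in cube d, ∫ t in (0:ℝ)..1, ‖μ t x • v t x‖ :=
          integral_mono (hm_cont.norm.continuousOn.integrableOn_compact hK)
            (hN_cont.continuousOn.integrableOn_compact hK) fun x => by
              simpa only [hm x] using intervalIntegral.norm_integral_le_integral_norm zero_le_one
      _ = ∫ t in (0:ℝ)..1, ∫ x in cube d, ‖μ t x • v t x‖ :=
          (intervalIntegral_setIntegral_swap_of_continuous hK hKm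
            (g := fun t x => ‖μ t x • v t x‖) hwc.norm 0 1).symm
      _ = ∫ t in (0:ℝ)..1, ∫ x in cube d, ‖v t x‖ * μ t x := by
          refine intervalIntegral.integral_congr fun t ht => setIntegral_congr_fun hKm fun x hx => ?_
          rw [Set.uIcc_of_le zero_le_one] at ht
          simp only [norm_smul, Real.norm_of_nonneg (hμnonneg t ht x hx), mul_comm]
  have hmass : |(∫ x in cube d, μ 0 x) - ∫ x in cube d, μ 1 x| ≤ ∫ t in (0:ℝ)..1, |f t| := by
    rw [abs_sub_comm, integral_sub_integral_eq_of_continuity_equation (w := fun t x => μ t x • v t x) hμ hw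
      (fun t ht x hx i hi => by simpa using hflux t ht x hx i hi) hpde]
    exact intervalIntegral.abs_integral_le_integral_abs zero_le_one
  gcongr
end

section
/- Let v : [0,1] × ℝ^d → ℝ^d be C², and let X : [0,1] × ℝ^d → ℝ^d be C² satisfying X(0,x) = x and ∂_t X(t,x) = v(t, X(t,x)) for all (t,x). Denote by D_x X(t,x) the spatial Jacobian matrix of X(t,·) at x. Then for every (t,x), ∂_t det(D_x X(t,x)) = (∇·v)(t, X(t,x)) · det(D_x X(t,x)), where ∇·v denotes the spatial divergence of v. -/
open MeasureTheory

/-- The determinant as a continuous multilinear function of the rows of a matrix. -/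
noncomputable def Matrix.detRowContinuousMultilinear (n : Type*) [Fintype n] [DecidableEq n] :
    ContinuousMultilinearMap ℝ (fun _ : n => n → ℝ) ℝ where
  toMultilinearMap := (Matrix.detRowAlternating (R := ℝ) (n := n)).toMultilinearMap
  cont := Continuous.matrix_det continuous_id

/-- **Jacobi's formula** for a matrix-valued function solving the linear equation `M' = A * M`. -/
theorem Matrix.hasDerivWithinAt_det_of_mul {n : Type*} [Fintype n] [DecidableEq n]
    {M : ℝ → Matrix n n ℝ} {A : Matrix n n ℝ} {S : Set ℝ} {t : ℝ}
    (h : ∀ i j, HasDerivWithinAt (fun s => M s i j) ((A * M t) i j) S t) :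
    HasDerivWithinAt (fun s => (M s).det) (A.trace * (M t).det) S t := by
  have hM : HasDerivWithinAt (fun s i j => M s i j) (fun i j => (A * M t) i j) S t :=
    hasDerivWithinAt_pi.2 fun i => hasDerivWithinAt_pi.2 fun j => h i j
  have hdet := ((Matrix.detRowContinuousMultilinear n).hasFDerivAt (M t)).comp_hasDerivWithinAt t hM
  refine hdet.congr_deriv ((ContinuousMultilinearMap.linearDeriv_apply _ _ _).trans ?_)
  rw [Matrix.trace, Finset.sum_mul]
  refine Finset.sum_congr rfl fun i _ => ?_
  have hrow : (fun j => (A * M t) i j) = ∑ k, A i k • M t k := by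
    ext j
    simp [Matrix.mul_apply]
  calc ((M t).updateRow i fun j => (A * M t) i j).det = A i i • (M t).det := by
        rw [hrow, Matrix.det_updateRow_sum]
    _ = A.diag i * (M t).det := rfl

/-- The equation of variations: the spatial derivative of a `C²` flow map solves the linearized
equation. -/
theorem hasDerivWithinAt_fderiv_flow {E : Type*} [NormedAddCommGroup E] [NormedSpace ℝ E]
    {v X : ℝ → E → E} {S : Set ℝ} (hS : UniqueDiffOn ℝ S)
    (hX : ContDiff ℝ 2 (fun p : ℝ × E => X p.1 p.2))
    (hode : ∀ t ∈ S, ∀ x, HasDerivWithinAt (fun s => X s x) (v t (X t x)) S t)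
    {t : ℝ} (ht : t ∈ S) {x : E} (hv : DifferentiableAt ℝ (v t) (X t x)) (e : E) :
    HasDerivWithinAt (fun s => fderiv ℝ (X s) x e)
      (fderiv ℝ (v t) (X t x) (fderiv ℝ (X t) x e)) S t := by
  set F : ℝ × E → E := fun p => X p.1 p.2
  have hFd : ∀ p, HasFDerivAt F (fderiv ℝ F p) p := fun p =>
    (hX.differentiable (by norm_num) p).hasFDerivAt
  have hF' : ∀ p, HasFDerivAt (fderiv ℝ F) (fderiv ℝ (fderiv ℝ F) p) p := fun p =>
    ((hX.fderiv_right (m := 1) (by norm_num)).differentiable (by norm_num) p).hasFDerivAt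
  have hspace : ∀ s y, HasFDerivAt (X s) (fderiv ℝ F (s, y) ∘L .inr ℝ ℝ E) y := fun s y =>
    (hFd (s, y)).comp y (hasFDerivAt_prodMk_right s y)
  have htime : ∀ y, fderiv ℝ F (t, y) (1, 0) = v t (X t y) := fun y => by
    have h1 : HasDerivAt (fun s => X s y) (fderiv ℝ F (t, y) (1, 0)) t :=
      HasFDerivAt.comp_hasDerivAt (l := F) t (hFd (t, y)) ((hasDerivAt_id t).prodMk (hasDerivAt_const t y))
    exact (hS t ht).eq_deriv S h1.hasDerivWithinAt (hode t ht y)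
  have hmixed : fderiv ℝ (fderiv ℝ F) (t, x) (0, e) (1, 0) =
      fderiv ℝ (v t) (X t x) (fderiv ℝ (X t) x e) := by
    have h1 : HasFDerivAt (fun y => fderiv ℝ F (t, y) (1, 0))
        ((ContinuousLinearMap.apply ℝ E ((1 : ℝ), (0 : E))) ∘L
          (fderiv ℝ (fderiv ℝ F) (t, x) ∘L .inr ℝ ℝ E)) x :=
      (ContinuousLinearMap.apply ℝ E ((1 : ℝ), (0 : E))).hasFDerivAt.comp x
        ((hF' (t, x)).comp x (hasFDerivAt_prodMk_right t x))
    have h2 : HasFDerivAt (fun y => v t (X t y))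
        (fderiv ℝ (v t) (X t x) ∘L fderiv ℝ (X t) x) x :=
      hv.hasFDerivAt.comp x (hspace t x).differentiableAt.hasFDerivAt
    simp only [htime] at h1
    exact congrArg (fun L : E →L[ℝ] E => L e) (h1.unique h2)
  have hsymm : IsSymmSndFDerivAt ℝ F (t, x) :=
    hX.contDiffAt.isSymmSndFDerivAt (by simp)
  have hline : HasDerivAt (fun s => fderiv ℝ F (s, x)) (fderiv ℝ (fderiv ℝ F) (t, x) (1, 0)) t :=
    (hF' (t, x)).comp_hasDerivAt t ((hasDerivAt_id t).prodMk (hasDerivAt_const t x))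
  have hmain : HasDerivAt (fun s => fderiv ℝ F (s, x) (0, e))
      (fderiv ℝ (fderiv ℝ F) (t, x) (1, 0) (0, e)) t :=
    (ContinuousLinearMap.apply ℝ E ((0 : ℝ), e)).hasFDerivAt.comp_hasDerivAt t hline
  rw [hsymm.eq, hmixed] at hmain
  have heq : (fun s => fderiv ℝ (X s) x e) = fun s => fderiv ℝ F (s, x) (0, e) := by
    funext s
    rw [(hspace s x).fderiv]
    rfl
  rw [heq]
  exact hmain.hasDerivWithinAt

/-- Jacobi identity for the Jacobian determinant of a flow map:
if `X(0,x) = x` and `∂_t X(t,x) = v(t, X(t,x))` on `[0,1]`, then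
`∂_t det (D_x X(t,x)) = (∇·v)(t, X(t,x)) · det (D_x X(t,x))`. -/
theorem stmt6 {d : ℕ}
    (v : ℝ → EuclideanSpace ℝ (Fin d) → EuclideanSpace ℝ (Fin d))
    (X : ℝ → EuclideanSpace ℝ (Fin d) → EuclideanSpace ℝ (Fin d))
    (hv : ContDiff ℝ 2 (fun p : ℝ × EuclideanSpace ℝ (Fin d) => v p.1 p.2))
    (hX : ContDiff ℝ 2 (fun p : ℝ × EuclideanSpace ℝ (Fin d) => X p.1 p.2))
    (hX0 : ∀ x, X 0 x = x)
    (hode : ∀ t ∈ Set.Icc (0:ℝ) 1, ∀ x,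
      HasDerivWithinAt (fun s => X s x) (v t (X t x)) (Set.Icc 0 1) t) :
    ∀ t ∈ Set.Icc (0:ℝ) 1, ∀ x,
      HasDerivWithinAt
        (fun s => LinearMap.det (fderiv ℝ (X s) x).toLinearMap)
        (diverg (v t) (X t x) * LinearMap.det (fderiv ℝ (X t) x).toLinearMap)
        (Set.Icc 0 1) t := by
  intro t ht x
  let b := (EuclideanSpace.basisFun (Fin d) ℝ).toBasis
  have hdet : ∀ L : EuclideanSpace ℝ (Fin d) →ₗ[ℝ] EuclideanSpace ℝ (Fin d),
      LinearMap.det L = (LinearMap.toMatrix b b L).det := fun L => (LinearMap.det_toMatrix b L).symm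
  have hentry : ∀ (L : EuclideanSpace ℝ (Fin d) →ₗ[ℝ] EuclideanSpace ℝ (Fin d)) i j,
      LinearMap.toMatrix b b L i j = L (EuclideanSpace.single j 1) i := fun L i j => by
    simp [b, LinearMap.toMatrix_apply]
  have htrace : diverg (v t) (X t x) =
      (LinearMap.toMatrix b b (fderiv ℝ (v t) (X t x)).toLinearMap).trace := by
    simp only [diverg, Matrix.trace, Matrix.diag, hentry]
    rfl
  have hvt : DifferentiableAt ℝ (v t) (X t x) :=
    ((hv.comp (contDiff_prodMk_right t)).differentiable (by norm_num)) _
  simp only [hdet, htrace]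
  refine Matrix.hasDerivWithinAt_det_of_mul fun i j => ?_
  rw [← LinearMap.toMatrix_comp]
  simp only [hentry]
  exact (EuclideanSpace.proj (𝕜 := ℝ) i).hasFDerivAt.comp_hasDerivWithinAt t
    (hasDerivWithinAt_fderiv_flow (uniqueDiffOn_Icc zero_lt_one) hX hode ht hvt
      (EuclideanSpace.single j 1))
end

section
/- Under the hypotheses: v : [0,1] × ℝ^d → ℝ^d is C², X : [0,1] × ℝ^d → ℝ^d is C² with X(0,x) = x and ∂_t X(t,x) = v(t, X(t,x)), μ : [0,1] × ℝ^d → ℝ is C¹, f : [0,1] → ℝ is continuous, and ∂_t μ(t,x) + ∇·(μ(t,x) v(t,x)) = f(t) holds for all (t,x); then for every t ∈ [0,1] and x ∈ ℝ^d, μ(t, X(t,x)) · det(D_x X(t,x)) = μ(0,x) + ∫₀^t f(s) · det(D_x X(s,x)) ds. -/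
open MeasureTheory

/-- **Liouville's formula** for matrices: if `M' = B M` at `t`, then
`(det M)' = tr B * det M` at `t`. -/
theorem Matrix.hasDerivAt_det_of_linear_ode {n : Type*} [Fintype n] [DecidableEq n]
    {M : ℝ → Matrix n n ℝ} {B : Matrix n n ℝ} {t : ℝ}
    (hM : ∀ i, HasDerivAt (fun s => M s i) ((B * M t) i) t) :
    HasDerivAt (fun s => (M s).det) (B.trace * (M t).det) t := by
  let D : ContinuousMultilinearMap ℝ (fun _ : n => n → ℝ) ℝ :=
    { (Matrix.detRowAlternating (R := ℝ) (n := n)).toMultilinearMap with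
      cont := Continuous.matrix_det (A := fun m : n → n → ℝ => Matrix.of m) continuous_id }
  have h := (HasFDerivAt.multilinear_comp D (fun i => (hM i).hasFDerivAt)).hasDerivAt
  refine h.congr_deriv ?_
  rw [Matrix.trace, Finset.sum_mul, _root_.sum_apply]
  refine Finset.sum_congr rfl fun i _ => ?_
  have hrow : (B * M t) i = ∑ k, B i k • M t k := by
    ext j
    simp [Matrix.mul_apply]
  have hdet := Matrix.det_updateRow_sum (M t) i (B i)
  rw [← hrow] at hdet
  rw [ContinuousLinearMap.comp_apply, ContinuousLinearMap.toSpanSingleton_apply, one_smul]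
  exact hdet

/-- **Liouville's formula** for endomorphisms of a finite-dimensional space: if `A' = B ∘ A` at
`t`, then `(det A)' = tr B * det A` at `t`. -/
theorem LinearMap.hasDerivAt_det_of_linear_ode {V : Type*} [NormedAddCommGroup V]
    [NormedSpace ℝ V] [FiniteDimensional ℝ V] {A : ℝ → V →L[ℝ] V} {B : V →L[ℝ] V} {t : ℝ}
    (hA : HasDerivAt A (B.comp (A t)) t) :
    HasDerivAt (fun s => LinearMap.det (A s).toLinearMap)
      (LinearMap.trace ℝ V B.toLinearMap * LinearMap.det (A t).toLinearMap) t := by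
  let b := Module.finBasis ℝ V
  simp only [← LinearMap.det_toMatrix b, LinearMap.trace_eq_matrix_trace ℝ b]
  refine Matrix.hasDerivAt_det_of_linear_ode fun i => hasDerivAt_pi.2 fun j => ?_
  rw [← LinearMap.toMatrix_comp b b b]
  have h := (LinearMap.toContinuousLinearMap (b.coord i)).hasFDerivAt.comp_hasDerivAt t
    (hA.clm_apply (hasDerivAt_const t (b j)))
  simpa [LinearMap.toMatrix_apply, Function.comp_def] using h

/-- The partial derivative in time of a function on space-time. -/
theorem HasFDerivAt.hasDerivAt_time {E F : Type*} [NormedAddCommGroup E] [NormedSpace ℝ E]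
    [NormedAddCommGroup F] [NormedSpace ℝ F] {G : ℝ × E → F} {G' : ℝ × E →L[ℝ] F} {t : ℝ} {x : E}
    (hG : HasFDerivAt G G' (t, x)) : HasDerivAt (fun s => G (s, x)) (G' (1, 0)) t :=
  hG.comp_hasDerivAt t ((hasDerivAt_id t).prodMk (hasDerivAt_const t x))

/-- The partial derivative in space of a function on space-time. -/
theorem HasFDerivAt.hasFDerivAt_space {E F : Type*} [NormedAddCommGroup E] [NormedSpace ℝ E]
    [NormedAddCommGroup F] [NormedSpace ℝ F] {G : ℝ × E → F} {G' : ℝ × E →L[ℝ] F} {t : ℝ} {x : E}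
    (hG : HasFDerivAt G G' (t, x)) :
    HasFDerivAt (fun y => G (t, y)) (G'.comp (ContinuousLinearMap.inr ℝ ℝ E)) x :=
  hG.comp x (hasFDerivAt_prodMk_right t x)

theorem fderiv_apply_eq_comp_inr {E F : Type*} [NormedAddCommGroup E] [NormedSpace ℝ E]
    [NormedAddCommGroup F] [NormedSpace ℝ F] {X : ℝ → E → F}
    (hX : Differentiable ℝ (fun p : ℝ × E => X p.1 p.2)) (t : ℝ) (x : E) :
    fderiv ℝ (X t) x =
      (fderiv ℝ (fun p : ℝ × E => X p.1 p.2) (t, x)).comp (ContinuousLinearMap.inr ℝ ℝ E) :=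
  (hX (t, x)).hasFDerivAt.hasFDerivAt_space.fderiv

/-- The spatial derivative of a `C²` flow solves the linearized equation. -/
theorem hasDerivAt_fderiv_flow {E : Type*} [NormedAddCommGroup E] [NormedSpace ℝ E]
    {X : ℝ → E → E} (hX : ContDiff ℝ 2 (fun p : ℝ × E => X p.1 p.2)) {t : ℝ} {w : E → E} {x : E}
    (hw : DifferentiableAt ℝ w (X t x))
    (hode : ∀ y, HasDerivAt (fun s => X s y) (w (X t y)) t) :
    HasDerivAt (fun s => fderiv ℝ (X s) x)
      ((fderiv ℝ w (X t x)).comp (fderiv ℝ (X t) x)) t := by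
  have hXd := hX.differentiable (by norm_num)
  have hfd := fderiv_apply_eq_comp_inr hXd
  have hXt : DifferentiableAt ℝ (X t) x :=
    (hXd (t, x)).hasFDerivAt.hasFDerivAt_space.differentiableAt
  have htime : ∀ y, fderiv ℝ (fun p : ℝ × E => X p.1 p.2) (t, y) (1, 0) = w (X t y) :=
    fun y => (hXd (t, y)).hasFDerivAt.hasDerivAt_time.unique (hode y)
  have hsymm : IsSymmSndFDerivAt ℝ (fun p : ℝ × E => X p.1 p.2) (t, x) :=
    hX.contDiffAt.isSymmSndFDerivAt (by simp)
  have hX2 := ((hX.fderiv_right (m := 1) (by norm_num)).differentiable (by norm_num)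
    (t, x)).hasFDerivAt
  have hspace := hX2.hasFDerivAt_space.clm_apply (hasFDerivAt_const ((1 : ℝ), (0 : E)) x)
  simp only [htime] at hspace
  have hchain : HasFDerivAt (fun y => w (X t y))
      ((fderiv ℝ w (X t x)).comp (fderiv ℝ (X t) x)) x := hw.hasFDerivAt.comp x hXt.hasFDerivAt
  have h := hX2.hasDerivAt_time.clm_comp
    (hasDerivAt_const t (ContinuousLinearMap.inr ℝ ℝ E))
  rw [hchain.unique hspace]
  simp only [hfd]
  refine h.congr_deriv ?_
  ext z
  simpa using hsymm (1, 0) (0, z)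

theorem diverg_eq_trace {d : ℕ} (w : EuclideanSpace ℝ (Fin d) → EuclideanSpace ℝ (Fin d))
    (x : EuclideanSpace ℝ (Fin d)) :
    diverg w x = LinearMap.trace ℝ _ (fderiv ℝ w x).toLinearMap := by
  rw [LinearMap.trace_eq_matrix_trace ℝ (EuclideanSpace.basisFun (Fin d) ℝ).toBasis]
  simp [diverg, Matrix.trace, LinearMap.toMatrix_apply]

/-- The product rule for the divergence of a scalar multiple of a vector field. -/
theorem diverg_smul {d : ℕ} {m : EuclideanSpace ℝ (Fin d) → ℝ}
    {w : EuclideanSpace ℝ (Fin d) → EuclideanSpace ℝ (Fin d)} {x : EuclideanSpace ℝ (Fin d)}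
    (hm : DifferentiableAt ℝ m x) (hw : DifferentiableAt ℝ w x) :
    diverg (fun y => m y • w y) x = m x * diverg w x + fderiv ℝ m x (w x) := by
  have hsum : w x = ∑ i, w x i • EuclideanSpace.single i (1 : ℝ) := by
    simpa using ((EuclideanSpace.basisFun (Fin d) ℝ).sum_repr (w x)).symm
  conv_rhs => rw [hsum, map_sum]
  simp only [diverg, fderiv_fun_smul hm hw, Finset.mul_sum, ← Finset.sum_add_distrib]
  refine Finset.sum_congr rfl fun i _ => ?_
  simp [mul_comm]

/-- Unnormalized push-forward relation: if `μ` solves the unnormalized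
continuity equation `∂_t μ + ∇·(μ v) = f(t)` and `X` is the flow of `v`, then
`μ(t, X(t,x)) det (D_x X(t,x)) = μ(0,x) + ∫₀ᵗ f(s) det (D_x X(s,x)) ds`. -/
theorem stmt8 {d : ℕ}
    (v : ℝ → EuclideanSpace ℝ (Fin d) → EuclideanSpace ℝ (Fin d))
    (X : ℝ → EuclideanSpace ℝ (Fin d) → EuclideanSpace ℝ (Fin d))
    (μ : ℝ → EuclideanSpace ℝ (Fin d) → ℝ)
    (f : ℝ → ℝ)
    (hv : ContDiff ℝ 2 (fun p : ℝ × EuclideanSpace ℝ (Fin d) => v p.1 p.2))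
    (hX : ContDiff ℝ 2 (fun p : ℝ × EuclideanSpace ℝ (Fin d) => X p.1 p.2))
    (hX0 : ∀ x, X 0 x = x)
    (hode : ∀ t ∈ Set.Icc (0:ℝ) 1, ∀ x,
      HasDerivWithinAt (fun s => X s x) (v t (X t x)) (Set.Icc 0 1) t)
    (hμ : ContDiff ℝ 1 (fun p : ℝ × EuclideanSpace ℝ (Fin d) => μ p.1 p.2))
    (hf : ContinuousOn f (Set.Icc 0 1))
    (hpde : ∀ t ∈ Set.Icc (0:ℝ) 1, ∀ x,
      deriv (fun s => μ s x) t + diverg (fun y => μ t y • v t y) x = f t) :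
    ∀ t ∈ Set.Icc (0:ℝ) 1, ∀ x,
      μ t (X t x) * LinearMap.det (fderiv ℝ (X t) x).toLinearMap
        = μ 0 x + ∫ s in (0:ℝ)..t, f s * LinearMap.det (fderiv ℝ (X s) x).toLinearMap := by
  intro t ht x
  have hXd := hX.differentiable (by norm_num)
  have hvd := hv.differentiable (by norm_num)
  have hμd := hμ.differentiable (by norm_num)
  have hdet : Continuous fun s => LinearMap.det (fderiv ℝ (X s) x).toLinearMap := by
    refine ContinuousLinearMap.continuous_det.comp (f := fun s => fderiv ℝ (X s) x) ?_
    simp only [fderiv_apply_eq_comp_inr hXd]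
    exact ((hX.continuous_fderiv (by norm_num)).comp
      (continuous_id.prodMk continuous_const)).clm_comp continuous_const
  have hXx : Continuous fun s => X s x :=
    hX.continuous.comp (continuous_id.prodMk continuous_const)
  have hμX : Continuous fun s => μ s (X s x) := hμ.continuous.comp (continuous_id.prodMk hXx)
  have hderiv : ∀ s ∈ Set.Ioo 0 t,
      HasDerivAt (fun s => μ s (X s x) * LinearMap.det (fderiv ℝ (X s) x).toLinearMap)
        (f s * LinearMap.det (fderiv ℝ (X s) x).toLinearMap) s := by
    intro s hs
    have hs1 : s < 1 := hs.2.trans_le ht.2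
    have hsI : s ∈ Set.Icc (0 : ℝ) 1 := ⟨hs.1.le, hs1.le⟩
    have hode' : ∀ y, HasDerivAt (fun r => X r y) (v s (X s y)) s := fun y =>
      (hode s hsI y).hasDerivAt (Icc_mem_nhds hs.1 hs1)
    have hvs : DifferentiableAt ℝ (v s) (X s x) :=
      (hvd (s, X s x)).hasFDerivAt.hasFDerivAt_space.differentiableAt
    have hμs : DifferentiableAt ℝ (μ s) (X s x) :=
      (hμd (s, X s x)).hasFDerivAt.hasFDerivAt_space.differentiableAt
    have hJ := LinearMap.hasDerivAt_det_of_linear_ode (hasDerivAt_fderiv_flow hX hvs hode')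
    have hm := (hμd (s, X s x)).hasFDerivAt.comp_hasDerivAt s
      ((hasDerivAt_id s).prodMk (hode' x))
    have htime : deriv (fun r => μ r (X s x)) s =
        fderiv ℝ (fun p : ℝ × EuclideanSpace ℝ (Fin d) => μ p.1 p.2) (s, X s x) (1, 0) :=
      (hμd (s, X s x)).hasFDerivAt.hasDerivAt_time.deriv
    have hsplit : ((1 : ℝ), v s (X s x)) = (1, 0) + (0, v s (X s x)) := by simp
    refine (hm.mul hJ).congr_deriv ?_
    rw [← hpde s hsI (X s x), diverg_smul hμs hvs, htime, fderiv_apply_eq_comp_inr hμd,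
      diverg_eq_trace, hsplit, map_add]
    simp only [ContinuousLinearMap.comp_apply, ContinuousLinearMap.inr_apply,
      Function.comp_apply, id]
    ring
  have hint : IntervalIntegrable
      (fun s => f s * LinearMap.det (fderiv ℝ (X s) x).toLinearMap) volume 0 t := by
    refine ContinuousOn.intervalIntegrable_of_Icc ht.1 ?_
    exact (hf.mono (Set.Icc_subset_Icc_right ht.2)).mul hdet.continuousOn
  have hid : X 0 = id := funext hX0
  rw [intervalIntegral.integral_eq_sub_of_hasDerivAt_of_le ht.1 (hμX.mul hdet).continuousOn
    hderiv hint]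
  simp [hid]
end
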